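/- arXiv:2206.06929 — 3 statements merged into one kernel-verified Lean document; each statement's English description precedes it below -/
import Mathlib

section
/- Under Assumptions (A5) and (A6), with scaling α_L = 1/L, the initial value problem H_0 = h_0, dH_t/dt = 𝒱_t g(H_t, Θ_t) for t ∈ [0,1] has a unique solution H : [0,1] → ℝ^d, and there exists a constant c > 0 such that for every depth L ≥ 1 and every 0 ≤ k ≤ L, ‖H_{k/L} − h_k‖ ≤ c/L, where (h_k)_{0≤k≤L} is the discrete ResNet sequence of depth L. -/
open Matrix

/-- The Euclidean norm of a vector in `ℝ^d`. -/
noncomputable def eucNorm {d : ℕ} (v : Fin d → ℝ) : ℝ := Real.sqrt (∑ i, v i ^ 2)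

/-- Coordinatewise truncation of a vector to the cube `[-R, R]^ι`. -/
def clampVec {ι : Type*} (R : ℝ) (x : ι → ℝ) : ι → ℝ := fun i => max (-R) (min R (x i))

section clampVec

variable {ι : Type*} [Fintype ι] {R : ℝ}

lemma norm_clampVec_sub_le (x y : ι → ℝ) : ‖clampVec R x - clampVec R y‖ ≤ ‖x - y‖ := by
  refine (pi_norm_le_iff_of_nonneg (norm_nonneg _)).2 fun i => ?_
  have h₁ : |max (-R) (min R (x i)) - max (-R) (min R (y i))| ≤ |min R (x i) - min R (y i)| := by
    simpa [max_comm (-R)] using abs_max_sub_max_le_abs (min R (x i)) (min R (y i)) (-R)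
  have h₂ : |min R (x i) - min R (y i)| ≤ |x i - y i| := by
    simpa using abs_min_sub_min_le_max R (x i) R (y i)
  exact (h₁.trans h₂).trans (norm_le_pi_norm (x - y) i)

lemma norm_clampVec_le (hR : 0 ≤ R) (x : ι → ℝ) : ‖clampVec R x‖ ≤ ‖x‖ := by
  have h0 : clampVec R (0 : ι → ℝ) = 0 := by
    funext i
    simp [clampVec, hR]
  simpa [h0] using norm_clampVec_sub_le (R := R) x 0

lemma norm_clampVec_le_radius (hR : 0 ≤ R) (x : ι → ℝ) : ‖clampVec R x‖ ≤ R := by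
  refine (pi_norm_le_iff_of_nonneg hR).2 fun i => abs_le.2 ⟨le_max_left _ _, ?_⟩
  exact max_le (by linarith) (min_le_left _ _)

lemma clampVec_eq_self {x : ι → ℝ} (hx : ‖x‖ ≤ R) : clampVec R x = x := by
  funext i
  have h := abs_le.1 ((norm_le_pi_norm x i).trans hx)
  simp [clampVec, h.1, h.2]

end clampVec

/-- A solution on `[0, 1]` of the initial value problem `H 0 = x₀`, `H' = f t H`. -/
def IsSolutionOnUnit {E : Type*} [NormedAddCommGroup E] [NormedSpace ℝ E]
    (f : ℝ → E → E) (x₀ : E) (H : ℝ → E) : Prop :=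
  H 0 = x₀ ∧ ∀ t ∈ Set.Icc (0 : ℝ) 1, HasDerivWithinAt H (f t (H t)) (Set.Icc 0 1) t

section IsSolutionOnUnit

variable {E : Type*} [NormedAddCommGroup E] [NormedSpace ℝ E] {f : ℝ → E → E} {x₀ : E}
  {H H' : ℝ → E}

lemma IsSolutionOnUnit.continuousOn (hH : IsSolutionOnUnit f x₀ H) :
    ContinuousOn H (Set.Icc 0 1) :=
  fun t ht => (hH.2 t ht).continuousWithinAt

lemma IsSolutionOnUnit.hasDerivWithinAt_Ici (hH : IsSolutionOnUnit f x₀ H) :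
    ∀ t ∈ Set.Ico (0 : ℝ) 1, HasDerivWithinAt H (f t (H t)) (Set.Ici t) t :=
  fun t ht => (hH.2 t (Set.Ico_subset_Icc_self ht)).mono_of_mem_nhdsWithin
    (Icc_mem_nhdsGE_of_mem ht)

lemma IsSolutionOnUnit.eqOn {K : ℝ} (hK : 0 ≤ K)
    (hf : ∀ t ∈ Set.Icc (0 : ℝ) 1, ∀ x y, ‖f t x - f t y‖ ≤ K * ‖x - y‖)
    (hH : IsSolutionOnUnit f x₀ H) (hH' : IsSolutionOnUnit f x₀ H') :
    Set.EqOn H H' (Set.Icc 0 1) := by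
  refine ODE_solution_unique_of_mem_Icc_right (K := K.toNNReal) (s := fun _ => Set.univ)
    (v := f) (fun t ht => ?_) hH.continuousOn hH.hasDerivWithinAt_Ici (fun _ _ => trivial)
    hH'.continuousOn hH'.hasDerivWithinAt_Ici (fun _ _ => trivial) (hH.1.trans hH'.1.symm)
  refine LipschitzOnWith.of_dist_le_mul fun x _ y _ => ?_
  rw [dist_eq_norm, dist_eq_norm, Real.coe_toNNReal _ hK]
  exact hf t (Set.Ico_subset_Icc_self ht) x y

/-- Global existence on `[0, 1]` for vector fields that are globally Lipschitz in space. -/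
lemma exists_isSolutionOnUnit {ι : Type*} [Fintype ι] {f : ℝ → (ι → ℝ) → (ι → ℝ)} {K : ℝ}
    (hK : 0 ≤ K) (hf : ∀ t ∈ Set.Icc (0 : ℝ) 1, ∀ x y, ‖f t x - f t y‖ ≤ K * ‖x - y‖)
    (hcont : ∀ x, ContinuousOn (f · x) (Set.Icc 0 1)) (x₀ : ι → ℝ) :
    ∃ H, IsSolutionOnUnit f x₀ H := by
  obtain ⟨A, hA⟩ := isCompact_Icc.exists_bound_of_continuousOn (hcont 0)
  have hA0 : 0 ≤ A := (norm_nonneg _).trans (hA 0 (by simp))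
  have hgrowth : ∀ t ∈ Set.Icc (0 : ℝ) 1, ∀ x, ‖f t x‖ ≤ K * ‖x‖ + A := fun t ht x => by
    have h₁ := norm_add_le (f t x - f t 0) (f t 0)
    have h₂ := hf t ht x 0
    rw [sub_add_cancel] at h₁
    rw [sub_zero] at h₂
    linarith [hA t ht]
  have hmono := gronwallBound_mono (norm_nonneg x₀) hA0 hK
  set R := gronwallBound ‖x₀‖ K A 1
  have hR0 : 0 ≤ R := by
    have := hmono zero_le_one
    rw [gronwallBound_x0] at this
    exact (norm_nonneg _).trans this
  have hN : 0 ≤ K * R + A := by positivity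
  have hPL : IsPicardLindelof (fun t x => f t (clampVec R x))
      (⟨0, by simp⟩ : Set.Icc (0 : ℝ) 1) x₀ ⟨K * R + A, hN⟩ 0 ⟨K * R + A, hN⟩ ⟨K, hK⟩ := by
    refine ⟨fun t ht => ?_, fun x _ => hcont _, fun t ht x _ => ?_, ?_⟩
    · refine LipschitzOnWith.of_dist_le_mul fun x _ y _ => ?_
      rw [dist_eq_norm, dist_eq_norm]
      exact (hf t ht _ _).trans (mul_le_mul_of_nonneg_left (norm_clampVec_sub_le x y) hK)
    · refine (hgrowth t ht _).trans ?_
      have := mul_le_mul_of_nonneg_left (norm_clampVec_le_radius hR0 x) hK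
      exact add_le_add_left this A
    · simp
  obtain ⟨H, hH⟩ := hPL.exists_eq_forall_mem_Icc_hasDerivWithinAt₀
  have hHsol : IsSolutionOnUnit (fun t x => f t (clampVec R x)) x₀ H := hH
  have hbound : ∀ t ∈ Set.Icc (0 : ℝ) 1, ‖H t‖ ≤ R := fun t ht => by
    have := norm_le_gronwallBound_of_norm_deriv_right_le hHsol.continuousOn
      hHsol.hasDerivWithinAt_Ici (congrArg norm hHsol.1).le (K := K) (ε := A) (fun s hs => ?_) t ht
    · rw [sub_zero] at this
      exact this.trans (hmono ht.2)
    · refine (hgrowth s (Set.Ico_subset_Icc_self hs) _).trans ?_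
      gcongr
      exact norm_clampVec_le hR0 _
  refine ⟨H, hHsol.1, fun t ht => ?_⟩
  have := hH.2 t ht
  rwa [clampVec_eq_self (hbound t ht)] at this

/-- The vector field along a solution, and the solution itself, are Lipschitz in time. -/
lemma IsSolutionOnUnit.exists_lipschitz_bounds {K : ℝ} (hK : 0 ≤ K)
    (hf : ∀ t ∈ Set.Icc (0 : ℝ) 1, ∀ x y, ‖f t x - f t y‖ ≤ K * ‖x - y‖)
    (htime : ∀ R : ℝ, ∃ M, 0 ≤ M ∧ ∀ s ∈ Set.Icc (0 : ℝ) 1, ∀ t ∈ Set.Icc (0 : ℝ) 1, ∀ x,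
      ‖x‖ ≤ R → ‖f s x - f t x‖ ≤ M * |s - t|)
    (hH : IsSolutionOnUnit f x₀ H) :
    ∃ B M, 0 ≤ B ∧ 0 ≤ M ∧ ∀ s ∈ Set.Icc (0 : ℝ) 1, ∀ t ∈ Set.Icc (0 : ℝ) 1,
      ‖H s - H t‖ ≤ B * |s - t| ∧ ‖f s (H s) - f t (H t)‖ ≤ M * |s - t| := by
  obtain ⟨R, hR⟩ := isCompact_Icc.exists_bound_of_continuousOn hH.continuousOn
  have h0 : (0 : ℝ) ∈ Set.Icc (0 : ℝ) 1 := by simp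
  have hR0 : 0 ≤ R := (norm_nonneg _).trans (hR 0 h0)
  obtain ⟨M, hM, hfM⟩ := htime R
  set B := ‖f 0 0‖ + M + K * R with hB
  have hB0 : 0 ≤ B := by positivity
  have hderiv : ∀ t ∈ Set.Icc (0 : ℝ) 1, ‖f t (H t)‖ ≤ B := fun t ht => by
    have h₁ : ‖f t (H t) - f t 0‖ ≤ K * R :=
      (hf t ht (H t) 0).trans (by simpa using mul_le_mul_of_nonneg_left (hR t ht) hK)
    have h₂ : ‖f t 0 - f 0 0‖ ≤ M := by
      refine (hfM t ht 0 h0 0 (by simpa using hR0)).trans (mul_le_of_le_one_right hM ?_)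
      rw [sub_zero, abs_of_nonneg ht.1]
      exact ht.2
    calc ‖f t (H t)‖ = ‖(f t (H t) - f t 0) + (f t 0 - f 0 0) + f 0 0‖ := by congr 1; abel
      _ ≤ ‖f t (H t) - f t 0‖ + ‖f t 0 - f 0 0‖ + ‖f 0 0‖ := norm_add₃_le
      _ ≤ B := by linarith
  have hlip : ∀ s ∈ Set.Icc (0 : ℝ) 1, ∀ t ∈ Set.Icc (0 : ℝ) 1, ‖H s - H t‖ ≤ B * |s - t| :=
    fun s hs t ht => (convex_Icc 0 1).norm_image_sub_le_of_norm_hasDerivWithin_le hH.2 hderiv ht hs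
  refine ⟨B, M + K * B, hB0, by positivity, fun s hs t ht => ⟨hlip s hs t ht, ?_⟩⟩
  calc ‖f s (H s) - f t (H t)‖
      ≤ ‖f s (H s) - f t (H s)‖ + ‖f t (H s) - f t (H t)‖ := norm_sub_le_norm_sub_add_norm_sub _ _ _
    _ ≤ M * |s - t| + K * (B * |s - t|) :=
      add_le_add (hfM s hs t ht _ (hR s hs))
        ((hf t ht _ _).trans (mul_le_mul_of_nonneg_left (hlip s hs t ht) hK))
    _ = (M + K * B) * |s - t| := by ring

/-- Local truncation error of the Euler step evaluated at the right endpoint in time. -/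
lemma IsSolutionOnUnit.norm_sub_sub_smul_le {M : ℝ} (hM : 0 ≤ M)
    (hfM : ∀ s ∈ Set.Icc (0 : ℝ) 1, ∀ t ∈ Set.Icc (0 : ℝ) 1,
      ‖f s (H s) - f t (H t)‖ ≤ M * |s - t|)
    (hH : IsSolutionOnUnit f x₀ H) {s t : ℝ} (hs : 0 ≤ s) (hst : s ≤ t) (ht : t ≤ 1) :
    ‖H t - H s - (t - s) • f t (H t)‖ ≤ M * (t - s) ^ 2 := by
  have hsub : Set.Icc s t ⊆ Set.Icc 0 1 := Set.Icc_subset_Icc hs ht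
  have hd : ∀ u ∈ Set.Icc s t, HasDerivWithinAt (fun u => H u - u • f t (H t))
      (f u (H u) - f t (H t)) (Set.Icc s t) u := fun u hu => by
    simpa using ((hH.2 u (hsub hu)).mono hsub).fun_sub
      ((hasDerivWithinAt_id u (Set.Icc s t)).smul_const (f t (H t)))
  have hb : ∀ u ∈ Set.Icc s t, ‖f u (H u) - f t (H t)‖ ≤ M * (t - s) := fun u hu => by
    refine (hfM u (hsub hu) t (hsub ⟨hst, le_rfl⟩)).trans (mul_le_mul_of_nonneg_left ?_ hM)
    rw [abs_sub_comm, abs_of_nonneg (by linarith [hu.2])]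
    linarith [hu.1]
  have := (convex_Icc s t).norm_image_sub_le_of_norm_hasDerivWithin_le hd hb
    (Set.left_mem_Icc.2 hst) (Set.right_mem_Icc.2 hst)
  rw [Real.norm_of_nonneg (sub_nonneg.2 hst)] at this
  calc ‖H t - H s - (t - s) • f t (H t)‖
      = ‖H t - t • f t (H t) - (H s - s • f t (H t))‖ := by rw [sub_smul]; congr 1; abel
    _ ≤ M * (t - s) ^ 2 := by rw [pow_two, ← mul_assoc]; exact this

/-- Global error of the Euler scheme with step `1 / L`, evaluated at right endpoints in time. -/
lemma IsSolutionOnUnit.norm_sub_euler_le {K B M : ℝ} (hK : 0 ≤ K) (hB : 0 ≤ B) (hM : 0 ≤ M)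
    (hf : ∀ t ∈ Set.Icc (0 : ℝ) 1, ∀ x y, ‖f t x - f t y‖ ≤ K * ‖x - y‖)
    (hlip : ∀ s ∈ Set.Icc (0 : ℝ) 1, ∀ t ∈ Set.Icc (0 : ℝ) 1,
      ‖H s - H t‖ ≤ B * |s - t| ∧ ‖f s (H s) - f t (H t)‖ ≤ M * |s - t|)
    (hH : IsSolutionOnUnit f x₀ H) {L : ℕ} (hL : 1 ≤ L) {h : ℕ → E} (h0 : h 0 = x₀)
    (hstep : ∀ k < L, h (k + 1) = h k + (1 / (L : ℝ)) • f (((k : ℝ) + 1) / L) (h k))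
    {k : ℕ} (hk : k ≤ L) :
    ‖H ((k : ℝ) / L) - h k‖ ≤ (M + K * B) * Real.exp K / L := by
  have hLpos : (0 : ℝ) < L := by exact_mod_cast hL
  have hone : ∀ j < L, ‖H (((j + 1 : ℕ) : ℝ) / L) - h (j + 1)‖ ≤
      (1 + K / L) * ‖H ((j : ℝ) / L) - h j‖ + (M + K * B) / L ^ 2 := fun j hj => by
    have hjL : (j : ℝ) + 1 ≤ L := by exact_mod_cast hj
    set s : ℝ := (j : ℝ) / L with hs
    set t : ℝ := ((j : ℝ) + 1) / L with ht
    have hts : t - s = 1 / L := by rw [hs, ht]; ring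
    have hst : s ≤ t := by
      have : (0 : ℝ) ≤ 1 / L := by positivity
      linarith
    have hs0 : 0 ≤ s := by positivity
    have ht1 : t ≤ 1 := (div_le_one hLpos).2 hjL
    have hsI : s ∈ Set.Icc (0 : ℝ) 1 := ⟨hs0, hst.trans ht1⟩
    have htI : t ∈ Set.Icc (0 : ℝ) 1 := ⟨hs0.trans hst, ht1⟩
    have e₁ := hH.norm_sub_sub_smul_le hM (fun s hs t ht => (hlip s hs t ht).2) hs0 hst ht1
    have e₂ : ‖f t (H t) - f t (h j)‖ ≤ K * (B * (1 / L) + ‖H s - h j‖) := by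
      refine (hf t htI _ _).trans (mul_le_mul_of_nonneg_left ?_ hK)
      refine (norm_sub_le_norm_sub_add_norm_sub _ (H s) _).trans (add_le_add_left ?_ _)
      have := (hlip t htI s hsI).1
      rwa [hts, abs_of_nonneg (by positivity)] at this
    rw [hts] at e₁
    have hsplit : H (((j + 1 : ℕ) : ℝ) / L) - h (j + 1) =
        (H t - H s - (1 / (L : ℝ)) • f t (H t)) + (H s - h j) +
          (1 / (L : ℝ)) • (f t (H t) - f t (h j)) := by
      rw [hstep j hj, smul_sub]
      push_cast
      abel
    rw [hsplit]
    calc _ ≤ ‖H t - H s - (1 / (L : ℝ)) • f t (H t)‖ + ‖H s - h j‖ +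
          ‖(1 / (L : ℝ)) • (f t (H t) - f t (h j))‖ := norm_add₃_le
      _ ≤ M * (1 / L) ^ 2 + ‖H s - h j‖ + 1 / L * (K * (B * (1 / L) + ‖H s - h j‖)) := by
        rw [norm_smul, Real.norm_of_nonneg (by positivity : (0 : ℝ) ≤ 1 / L)]
        gcongr
      _ = _ := by ring
  have hgron := discrete_gronwall (n₀ := 0) (c := fun _ => K / L)
    (b := fun _ => (M + K * B) / (L : ℝ) ^ 2)
    (u := fun n => ‖H (((min n L : ℕ) : ℝ) / L) - h (min n L)‖) (norm_nonneg _)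
    (fun n _ => ?_) (fun _ _ => by positivity) (fun _ _ => by positivity) (Nat.zero_le k)
  · have hkL : (k : ℝ) ≤ L := by exact_mod_cast hk
    simp only [min_eq_left hk, Nat.zero_min, Nat.cast_zero, zero_div, hH.1, h0, sub_self,
      norm_zero, zero_add, Finset.sum_const, Nat.card_Ico, tsub_zero, nsmul_eq_mul] at hgron
    calc _ ≤ _ := hgron
      _ ≤ (L * ((M + K * B) / L ^ 2)) * Real.exp (L * (K / L)) := by gcongr
      _ = (M + K * B) * Real.exp K / L := by
        rw [mul_div_cancel₀ _ hLpos.ne']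
        field_simp
  · rcases lt_or_ge n L with hn | hn
    · simpa [min_eq_left hn.le, min_eq_left (Nat.succ_le_of_lt hn)] using hone n hn
    · simp only [min_eq_right hn, min_eq_right (hn.trans n.le_succ)]
      have : 0 ≤ K / L * ‖H ((L : ℝ) / L) - h L‖ := by positivity
      have : 0 ≤ (M + K * B) / (L : ℝ) ^ 2 := by positivity
      linarith

end IsSolutionOnUnit

lemma norm_le_eucNorm {n : ℕ} (v : Fin n → ℝ) : ‖v‖ ≤ eucNorm v := by
  refine (pi_norm_le_iff_of_nonneg (Real.sqrt_nonneg _)).2 fun i => Real.abs_le_sqrt ?_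
  exact Finset.single_le_sum (f := fun i => v i ^ 2) (fun i _ => sq_nonneg _) (Finset.mem_univ i)

lemma eucNorm_le_sqrt_mul_norm {n : ℕ} (v : Fin n → ℝ) : eucNorm v ≤ √n * ‖v‖ := by
  rw [eucNorm, Real.sqrt_le_left (by positivity), mul_pow, Real.sq_sqrt n.cast_nonneg]
  calc ∑ i, v i ^ 2 ≤ ∑ _i : Fin n, ‖v‖ ^ 2 :=
        Finset.sum_le_sum fun i _ => sq_le_sq' (abs_le.1 (norm_le_pi_norm v i)).1
          (abs_le.1 (norm_le_pi_norm v i)).2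
    _ = n * ‖v‖ ^ 2 := by simp

lemma norm_of_mulVec_le {m n : ℕ} (A : Fin m → Fin n → ℝ) (v : Fin n → ℝ) :
    ‖Matrix.of A *ᵥ v‖ ≤ n * ‖A‖ * ‖v‖ := by
  refine (pi_norm_le_iff_of_nonneg (by positivity)).2 fun i => ?_
  calc ‖∑ j, A i j * v j‖ ≤ ∑ j, ‖A i j * v j‖ := norm_sum_le _ _
    _ ≤ ∑ _j : Fin n, ‖A‖ * ‖v‖ := Finset.sum_le_sum fun j _ => by
      rw [norm_mul]
      gcongr
      · exact (norm_le_pi_norm (A i) j).trans (norm_le_pi_norm A i)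
      · exact norm_le_pi_norm v j
    _ = n * ‖A‖ * ‖v‖ := by simp [mul_assoc]

/-- under Assumptions (A5) and (A6), with scaling `α_L = 1/L`, the initial
value problem `H_0 = h₀`, `dH_t/dt = 𝒱_t g(H_t, Θ_t)` on `[0,1]` has a unique solution `H`,
and there is `c > 0` such that for every depth `L ≥ 1` and `0 ≤ k ≤ L`,
`‖H_{k/L} − h_k‖ ≤ c/L`, where `(h_k)` is the discrete ResNet sequence of depth `L`. -/
theorem stmt14 (d p : ℕ) (hd : 1 ≤ d) (hp : 1 ≤ p)
    (𝒱 : ℝ → (Fin d → Fin d → ℝ)) (Θ : ℝ → (Fin p → ℝ))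
    -- Assumption (A5): 𝒱 and Θ are Lipschitz continuous and bounded on [0,1]:
    (K𝒱 KΘ : NNReal)
    (h𝒱lip : LipschitzOnWith K𝒱 𝒱 (Set.Icc 0 1))
    (hΘlip : LipschitzOnWith KΘ Θ (Set.Icc 0 1))
    (h𝒱bdd : ∃ M : ℝ, ∀ t ∈ Set.Icc (0 : ℝ) 1, ‖𝒱 t‖ ≤ M)
    (hΘbdd : ∃ M : ℝ, ∀ t ∈ Set.Icc (0 : ℝ) 1, ‖Θ t‖ ≤ M)
    (g : (Fin d → ℝ) → (Fin p → ℝ) → (Fin d → ℝ))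
    -- Assumption (A6): g is Lipschitz continuous on compact sets:
    (hA6₁ : ∀ P : Set (Fin p → ℝ), IsCompact P → ∃ K > (0 : ℝ),
      ∀ (x y : Fin d → ℝ), ∀ θv ∈ P, eucNorm (g x θv - g y θv) ≤ K * eucNorm (x - y))
    (hA6₂ : ∀ (D : Set (Fin d → ℝ)) (P : Set (Fin p → ℝ)), IsCompact D → IsCompact P →
      ∃ K > (0 : ℝ), ∀ x ∈ D, ∀ θv ∈ P, ∀ θv' ∈ P,
        eucNorm (g x θv - g x θv') ≤ K * eucNorm (θv - θv'))
    (h₀ : Fin d → ℝ) :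
    ∃ H : ℝ → (Fin d → ℝ),
      (H 0 = h₀ ∧ ∀ t ∈ Set.Icc (0 : ℝ) 1,
        HasDerivWithinAt H (Matrix.of (𝒱 t) *ᵥ g (H t) (Θ t)) (Set.Icc 0 1) t) ∧
      (∀ H' : ℝ → (Fin d → ℝ),
        (H' 0 = h₀ ∧ ∀ t ∈ Set.Icc (0 : ℝ) 1,
          HasDerivWithinAt H' (Matrix.of (𝒱 t) *ᵥ g (H' t) (Θ t)) (Set.Icc 0 1) t) →
        ∀ t ∈ Set.Icc (0 : ℝ) 1, H' t = H t) ∧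
      ∃ c > (0 : ℝ), ∀ L : ℕ, 1 ≤ L → ∀ hseq : ℕ → (Fin d → ℝ),
        hseq 0 = h₀ →
        (∀ k < L, hseq (k + 1) = hseq k +
          (1 / (L : ℝ)) • (Matrix.of (𝒱 (((k : ℝ) + 1) / (L : ℝ))) *ᵥ
            g (hseq k) (Θ (((k : ℝ) + 1) / (L : ℝ))))) →
        ∀ k ≤ L, eucNorm (H ((k : ℝ) / (L : ℝ)) - hseq k) ≤ c / (L : ℝ) := by
  have h0I : (0 : ℝ) ∈ Set.Icc (0 : ℝ) 1 := by simp
  obtain ⟨MV, hMV⟩ := h𝒱bdd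
  obtain ⟨MΘ, hMΘ⟩ := hΘbdd
  have hMV0 : 0 ≤ MV := (norm_nonneg _).trans (hMV 0 h0I)
  set P := Metric.closedBall (0 : Fin p → ℝ) MΘ with hP
  have hPc : IsCompact P := isCompact_closedBall _ _
  have hΘP : ∀ t ∈ Set.Icc (0 : ℝ) 1, Θ t ∈ P := fun t ht => by simpa [hP] using hMΘ t ht
  obtain ⟨Kg, hKg, hg⟩ := hA6₁ P hPc
  have hg_space : ∀ x y, ∀ θ ∈ P, ‖g x θ - g y θ‖ ≤ Kg * √d * ‖x - y‖ := fun x y θ hθ => by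
    calc _ ≤ _ := (norm_le_eucNorm _).trans (hg x y θ hθ)
      _ ≤ Kg * (√d * ‖x - y‖) := by gcongr; exact eucNorm_le_sqrt_mul_norm _
      _ = _ := by ring
  set f : ℝ → (Fin d → ℝ) → (Fin d → ℝ) := fun t x => Matrix.of (𝒱 t) *ᵥ g x (Θ t) with hf
  set K : ℝ := d * MV * (Kg * √d)
  have hK0 : 0 ≤ K := by positivity
  have hf_space : ∀ t ∈ Set.Icc (0 : ℝ) 1, ∀ x y, ‖f t x - f t y‖ ≤ K * ‖x - y‖ :=
    fun t ht x y => by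
      simp only [hf, ← Matrix.mulVec_sub]
      calc _ ≤ d * ‖𝒱 t‖ * ‖g x (Θ t) - g y (Θ t)‖ := norm_of_mulVec_le _ _
        _ ≤ d * MV * (Kg * √d * ‖x - y‖) := by
          gcongr
          · exact hMV t ht
          · exact hg_space x y _ (hΘP t ht)
        _ = K * ‖x - y‖ := by ring
  have hf_time : ∀ R : ℝ, ∃ M, 0 ≤ M ∧ ∀ s ∈ Set.Icc (0 : ℝ) 1, ∀ t ∈ Set.Icc (0 : ℝ) 1, ∀ x,
      ‖x‖ ≤ R → ‖f s x - f t x‖ ≤ M * |s - t| := fun R => by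
    obtain ⟨Kθ, hKθ, hgθ⟩ := hA6₂ (Metric.closedBall 0 R) P (isCompact_closedBall _ _) hPc
    have hg_param : ∀ x, ‖x‖ ≤ R → ∀ s ∈ Set.Icc (0 : ℝ) 1, ∀ t ∈ Set.Icc (0 : ℝ) 1,
        ‖g x (Θ s) - g x (Θ t)‖ ≤ Kθ * √p * KΘ * |s - t| := fun x hx s hs t ht => by
      calc _ ≤ Kθ * eucNorm (Θ s - Θ t) := (norm_le_eucNorm _).trans
            (hgθ x (by simpa using hx) _ (hΘP s hs) _ (hΘP t ht))
        _ ≤ Kθ * (√p * ‖Θ s - Θ t‖) := by gcongr; exact eucNorm_le_sqrt_mul_norm _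
        _ ≤ Kθ * (√p * (KΘ * |s - t|)) := by
          gcongr
          simpa [dist_eq_norm] using hΘlip.dist_le_mul s hs t ht
        _ = _ := by ring
    set G : ℝ := Kg * √d * |R| + Kθ * √p * KΘ + ‖g 0 (Θ 0)‖ with hG
    have hg_bdd : ∀ x, ‖x‖ ≤ R → ∀ t ∈ Set.Icc (0 : ℝ) 1, ‖g x (Θ t)‖ ≤ G := fun x hx t ht => by
      have h₁ : ‖g x (Θ t) - g 0 (Θ t)‖ ≤ Kg * √d * |R| := by
        refine (hg_space x 0 _ (hΘP t ht)).trans ?_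
        rw [sub_zero]
        gcongr
        exact hx.trans (le_abs_self R)
      have h₂ : ‖g 0 (Θ t) - g 0 (Θ 0)‖ ≤ Kθ * √p * KΘ := by
        refine (hg_param 0 (by simpa using (norm_nonneg x).trans hx) t ht 0 h0I).trans
          (mul_le_of_le_one_right (by positivity) ?_)
        rw [sub_zero, abs_of_nonneg ht.1]
        exact ht.2
      calc ‖g x (Θ t)‖
          = ‖(g x (Θ t) - g 0 (Θ t)) + (g 0 (Θ t) - g 0 (Θ 0)) + g 0 (Θ 0)‖ := by
            congr 1; abel
        _ ≤ _ := norm_add₃_le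
        _ ≤ G := by rw [hG]; gcongr
    have hG0 : 0 ≤ G := by positivity
    refine ⟨d * MV * (Kθ * √p * KΘ) + d * K𝒱 * G, by positivity, fun s hs t ht x hx => ?_⟩
    have hsplit : f s x - f t x = Matrix.of (𝒱 s) *ᵥ (g x (Θ s) - g x (Θ t)) +
        Matrix.of (𝒱 s - 𝒱 t) *ᵥ g x (Θ t) := by
      rw [← Matrix.of_sub_of, Matrix.sub_mulVec, Matrix.mulVec_sub]
      simp only [hf]
      abel
    rw [hsplit]
    calc _ ≤ d * ‖𝒱 s‖ * ‖g x (Θ s) - g x (Θ t)‖ + d * ‖𝒱 s - 𝒱 t‖ * ‖g x (Θ t)‖ :=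
          norm_add_le_of_le (norm_of_mulVec_le _ _) (norm_of_mulVec_le _ _)
      _ ≤ d * MV * (Kθ * √p * KΘ * |s - t|) + d * (K𝒱 * |s - t|) * G := by
        gcongr
        · exact hMV s hs
        · exact hg_param x hx s hs t ht
        · simpa [dist_eq_norm] using h𝒱lip.dist_le_mul s hs t ht
        · exact hg_bdd x hx t ht
      _ = _ := by ring
  have hf_cont : ∀ x, ContinuousOn (f · x) (Set.Icc 0 1) := fun x => by
    obtain ⟨M, hM, hfM⟩ := hf_time ‖x‖
    refine (LipschitzOnWith.of_dist_le_mul (K := ⟨M, hM⟩) fun s hs t ht => ?_).continuousOn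
    rw [dist_eq_norm, Real.dist_eq]
    exact hfM s hs t ht x le_rfl
  obtain ⟨H, hH⟩ := exists_isSolutionOnUnit hK0 hf_space hf_cont h₀
  refine ⟨H, hH, fun H' hH' => IsSolutionOnUnit.eqOn hK0 hf_space hH' hH, ?_⟩
  obtain ⟨B, M, hB, hM, hlip⟩ := hH.exists_lipschitz_bounds hK0 hf_space hf_time
  refine ⟨√d * ((M + K * B) * Real.exp K) + 1, by positivity,
    fun L hL hseq hseq0 hstep k hk => ?_⟩
  have herr := hH.norm_sub_euler_le hK0 hB hM hf_space hlip hL hseq0 hstep hk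
  calc _ ≤ √d * ‖H ((k : ℝ) / L) - hseq k‖ := eucNorm_le_sqrt_mul_norm _
    _ ≤ √d * ((M + K * B) * Real.exp K / L) := by gcongr
    _ = √d * ((M + K * B) * Real.exp K) / L := by ring
    _ ≤ _ := by gcongr; linarith
end

section
/- Under Assumptions (A5) and (A6), with h_0 ≠ 0 and scaling α_L = L^{−β}: (i) if β > 1, then ‖h_L − h_0‖/‖h_0‖ → 0 as L → ∞; (ii) if β = 1, then there exists c > 0 such that ‖h_L − h_0‖/‖h_0‖ ≤ c for all L ≥ 1, where for each L, (h_k)_{0≤k≤L} is the discrete ResNet sequence of depth L and h_L its final state. -/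
open Matrix

theorem eucNorm_eq_norm_toLp {d : ℕ} (v : Fin d → ℝ) : eucNorm v = ‖WithLp.toLp 2 v‖ := by
  simp [eucNorm, EuclideanSpace.norm_eq]

theorem eucNorm_nonneg {d : ℕ} (v : Fin d → ℝ) : 0 ≤ eucNorm v := Real.sqrt_nonneg _

theorem eucNorm_add_le {d : ℕ} (v w : Fin d → ℝ) : eucNorm (v + w) ≤ eucNorm v + eucNorm w := by
  simpa only [eucNorm_eq_norm_toLp, WithLp.toLp_add] using norm_add_le _ _

theorem eucNorm_smul {d : ℕ} (a : ℝ) (v : Fin d → ℝ) : eucNorm (a • v) = |a| * eucNorm v := by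
  simp only [eucNorm_eq_norm_toLp, WithLp.toLp_smul, norm_smul, Real.norm_eq_abs]

theorem continuous_eucNorm {d : ℕ} : Continuous (eucNorm : (Fin d → ℝ) → ℝ) := by
  unfold eucNorm
  fun_prop

theorem eucNorm_mulVec_le {d : ℕ} (A : Fin d → Fin d → ℝ) {M : ℝ} (hA : ‖A‖ ≤ M)
    (v : Fin d → ℝ) : eucNorm (Matrix.of A *ᵥ v) ≤ d * M * eucNorm v := by
  have hM : 0 ≤ M := (norm_nonneg A).trans hA
  have hentry (i j : Fin d) : A i j ^ 2 ≤ M ^ 2 := by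
    refine sq_le_sq' ?_ ?_ <;>
      linarith [abs_le.mp (((norm_le_pi_norm (A i) j).trans (norm_le_pi_norm A i)).trans hA)]
  have hrow (i : Fin d) : (Matrix.of A *ᵥ v) i ^ 2 ≤ d * M ^ 2 * ∑ j, v j ^ 2 := by
    calc (∑ j, A i j * v j) ^ 2 ≤ (∑ j, A i j ^ 2) * ∑ j, v j ^ 2 :=
          Finset.sum_mul_sq_le_sq_mul_sq _ _ _
      _ ≤ (∑ _j : Fin d, M ^ 2) * ∑ j, v j ^ 2 := by
          gcongr ?_ * _
          exact Finset.sum_le_sum fun j _ => hentry i j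
      _ = _ := by simp
  refine Real.sqrt_le_iff.mpr ⟨by have := eucNorm_nonneg v; positivity, ?_⟩
  calc ∑ i, (Matrix.of A *ᵥ v) i ^ 2 ≤ ∑ _i : Fin d, d * M ^ 2 * ∑ j, v j ^ 2 :=
        Finset.sum_le_sum fun i _ => hrow i
    _ = (d * M) ^ 2 * ∑ j, v j ^ 2 := by simp; ring
    _ = (d * M * eucNorm v) ^ 2 := by
        rw [mul_pow _ (eucNorm v), eucNorm, Real.sq_sqrt (by positivity)]

/-- A discrete Grönwall inequality for affine recursions started at `0`. -/
theorem le_exp_mul_of_affine_recursion {e : ℕ → ℝ} {b c : ℝ} {n : ℕ} (hb : 0 ≤ b) (hc : 0 ≤ c)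
    (h0 : e 0 = 0) (hstep : ∀ k < n, e (k + 1) ≤ (1 + b) * e k + c) :
    ∀ k ≤ n, e k ≤ k * c * Real.exp (b * k) := by
  intro k
  induction k with
  | zero => simp [h0]
  | succ k ih =>
    intro hk
    have hexp : (1 + b) * Real.exp (b * k) ≤ Real.exp (b * (k + 1 : ℕ)) := by
      have : b * (k + 1 : ℕ) = b + b * k := by push_cast; ring
      rw [this, Real.exp_add]
      gcongr
      linarith [Real.add_one_le_exp b]
    have hone : 1 ≤ Real.exp (b * (k + 1 : ℕ)) := Real.one_le_exp (by positivity)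
    calc e (k + 1) ≤ (1 + b) * e k + c := hstep k hk
      _ ≤ (1 + b) * (k * c * Real.exp (b * k)) + c := by
          gcongr
          exact ih (by lia)
      _ = k * c * ((1 + b) * Real.exp (b * k)) + c * 1 := by ring
      _ ≤ k * c * Real.exp (b * (k + 1 : ℕ)) + c * Real.exp (b * (k + 1 : ℕ)) := by gcongr
      _ = _ := by push_cast; ring

/-- under Assumptions (A5) and (A6), with `h₀ ≠ 0` and scaling `α_L = L^{−β}`:
(i) if `β > 1` then `‖h_L − h_0‖/‖h_0‖ → 0` as `L → ∞`; (ii) if `β = 1` then there exists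
`c > 0` with `‖h_L − h_0‖/‖h_0‖ ≤ c` for all `L ≥ 1`. -/
theorem stmt15 (d p : ℕ) (hd : 1 ≤ d) (hp : 1 ≤ p)
    (𝒱 : ℝ → (Fin d → Fin d → ℝ)) (Θ : ℝ → (Fin p → ℝ))
    -- Assumption (A5): 𝒱 and Θ are Lipschitz continuous and bounded on [0,1]:
    (K𝒱 KΘ : NNReal)
    (h𝒱lip : LipschitzOnWith K𝒱 𝒱 (Set.Icc 0 1))
    (hΘlip : LipschitzOnWith KΘ Θ (Set.Icc 0 1))
    (h𝒱bdd : ∃ M : ℝ, ∀ t ∈ Set.Icc (0 : ℝ) 1, ‖𝒱 t‖ ≤ M)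
    (hΘbdd : ∃ M : ℝ, ∀ t ∈ Set.Icc (0 : ℝ) 1, ‖Θ t‖ ≤ M)
    (g : (Fin d → ℝ) → (Fin p → ℝ) → (Fin d → ℝ))
    -- Assumption (A6): g is Lipschitz continuous on compact sets:
    (hA6₁ : ∀ P : Set (Fin p → ℝ), IsCompact P → ∃ K > (0 : ℝ),
      ∀ (x y : Fin d → ℝ), ∀ θv ∈ P, eucNorm (g x θv - g y θv) ≤ K * eucNorm (x - y))
    (hA6₂ : ∀ (D : Set (Fin d → ℝ)) (P : Set (Fin p → ℝ)), IsCompact D → IsCompact P →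
      ∃ K > (0 : ℝ), ∀ x ∈ D, ∀ θv ∈ P, ∀ θv' ∈ P,
        eucNorm (g x θv - g x θv') ≤ K * eucNorm (θv - θv'))
    (β : ℝ)
    (h₀ : Fin d → ℝ) (hh₀ : h₀ ≠ 0)
    -- for each depth L, the discrete ResNet sequence with scaling α_L = L^{-β}:
    (h : (L : ℕ) → ℕ → (Fin d → ℝ))
    (hinit : ∀ L, h L 0 = h₀)
    (hrec : ∀ L : ℕ, ∀ k < L, h L (k + 1) = h L k +
      ((L : ℝ) ^ (-β) : ℝ) • (Matrix.of (𝒱 (((k : ℝ) + 1) / (L : ℝ))) *ᵥ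
        g (h L k) (Θ (((k : ℝ) + 1) / (L : ℝ))))) :
    (1 < β → Filter.Tendsto (fun L : ℕ => eucNorm (h L L - h₀) / eucNorm h₀)
      Filter.atTop (nhds 0)) ∧
    (β = 1 → ∃ c > (0 : ℝ), ∀ L : ℕ, 1 ≤ L → eucNorm (h L L - h₀) / eucNorm h₀ ≤ c) := by
  obtain ⟨M, hM⟩ := h𝒱bdd
  have hM0 : 0 ≤ M := (norm_nonneg _).trans (hM 0 (by simp))
  have hcpt : IsCompact (Θ '' Set.Icc 0 1) := isCompact_Icc.image_of_continuousOn hΘlip.continuousOn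
  have hΘmem {t : ℝ} (ht : t ∈ Set.Icc (0 : ℝ) 1) : Θ t ∈ Θ '' Set.Icc 0 1 :=
    Set.mem_image_of_mem Θ ht
  obtain ⟨K, hK, hgx⟩ := hA6₁ _ hcpt
  obtain ⟨G, hG0, hG⟩ : ∃ G ≥ 0, ∀ t ∈ Set.Icc (0 : ℝ) 1, eucNorm (g h₀ (Θ t)) ≤ G := by
    obtain ⟨K', hK', hgθ⟩ := hA6₂ {h₀} _ isCompact_singleton hcpt
    obtain ⟨B, hB⟩ := hcpt.bddAbove_image (f := fun θ => eucNorm (θ - Θ 0))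
      (continuous_eucNorm.comp (continuous_id.sub continuous_const)).continuousOn
    have hle : ∀ t ∈ Set.Icc (0 : ℝ) 1, eucNorm (g h₀ (Θ t)) ≤ K' * B + eucNorm (g h₀ (Θ 0)) := by
      intro t ht
      have hadd := eucNorm_add_le (g h₀ (Θ t) - g h₀ (Θ 0)) (g h₀ (Θ 0))
      rw [sub_add_cancel] at hadd
      have hlip := hgθ h₀ rfl _ (hΘmem ht) _ (hΘmem (t := 0) (by simp))
      have hdist : eucNorm (Θ t - Θ 0) ≤ B := hB (Set.mem_image_of_mem _ (hΘmem ht))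
      linarith [mul_le_mul_of_nonneg_left hdist hK'.le]
    exact ⟨_, (eucNorm_nonneg _).trans (hle 0 (by simp)), hle⟩
  set C : ℝ := d * M
  have hC : 0 ≤ C := by positivity
  have hstep : ∀ L : ℕ, ∀ k < L, eucNorm (h L (k + 1) - h₀) ≤
      (1 + (L : ℝ) ^ (-β) * C * K) * eucNorm (h L k - h₀) + (L : ℝ) ^ (-β) * C * G := by
    intro L k hk
    have ht : ((k : ℝ) + 1) / L ∈ Set.Icc (0 : ℝ) 1 :=
      ⟨by positivity, div_le_one_of_le₀ (by exact_mod_cast hk) (by positivity)⟩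
    rw [hrec L k hk, add_sub_right_comm]
    refine (eucNorm_add_le _ _).trans ?_
    rw [eucNorm_smul, abs_of_nonneg (by positivity)]
    have hg : eucNorm (g (h L k) (Θ (((k : ℝ) + 1) / L))) ≤ K * eucNorm (h L k - h₀) + G := by
      have hadd := eucNorm_add_le (g (h L k) (Θ (((k : ℝ) + 1) / L)) - g h₀ (Θ (((k : ℝ) + 1) / L)))
        (g h₀ (Θ (((k : ℝ) + 1) / L)))
      rw [sub_add_cancel] at hadd
      linarith [hgx (h L k) h₀ _ (hΘmem ht), hG _ ht]
    calc eucNorm (h L k - h₀) + (L : ℝ) ^ (-β) * eucNorm _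
        ≤ eucNorm (h L k - h₀) + (L : ℝ) ^ (-β) * (C * (K * eucNorm (h L k - h₀) + G)) := by
          gcongr
          exact (eucNorm_mulVec_le _ (hM _ ht) _).trans (by gcongr)
      _ = _ := by ring
  have hbound (L : ℕ) (hL : 1 ≤ L) : eucNorm (h L L - h₀) ≤
      (L : ℝ) ^ (1 - β) * (C * G) * Real.exp ((L : ℝ) ^ (1 - β) * (C * K)) := by
    have hL0 : (0 : ℝ) < L := by exact_mod_cast hL
    have hpow : (L : ℝ) ^ (1 - β) = L * (L : ℝ) ^ (-β) := by
      rw [sub_eq_add_neg, Real.rpow_add hL0, Real.rpow_one]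
    have h0 : eucNorm (h L 0 - h₀) = 0 := by simp [hinit, eucNorm]
    refine (le_exp_mul_of_affine_recursion (e := fun k => eucNorm (h L k - h₀)) (by positivity)
      (by positivity) h0 (hstep L) L le_rfl).trans_eq ?_
    rw [hpow]
    ring_nf
  refine ⟨fun hβ => ?_, fun hβ => ?_⟩
  · have hpow : Filter.Tendsto (fun L : ℕ => (L : ℝ) ^ (1 - β)) Filter.atTop (nhds 0) := by
      have := (tendsto_rpow_neg_atTop (sub_pos.mpr hβ)).comp tendsto_natCast_atTop_atTop
      simpa only [neg_sub, Function.comp_def] using this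
    have hlim : Filter.Tendsto (fun L : ℕ => (L : ℝ) ^ (1 - β) * (C * G) *
        Real.exp ((L : ℝ) ^ (1 - β) * (C * K)) / eucNorm h₀) Filter.atTop (nhds 0) := by
      simpa using ((hpow.mul_const (C * G)).mul
        ((Real.continuous_exp.tendsto _).comp (hpow.mul_const (C * K)))).div_const (eucNorm h₀)
    refine squeeze_zero' (.of_forall fun L => div_nonneg (eucNorm_nonneg _) (eucNorm_nonneg _))
      ?_ hlim
    filter_upwards [Filter.eventually_ge_atTop 1] with L hL
    exact div_le_div_of_nonneg_right (hbound L hL) (eucNorm_nonneg _)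
  · have hnn := eucNorm_nonneg h₀
    refine ⟨C * G * Real.exp (C * K) / eucNorm h₀ + 1, by positivity, fun L hL => ?_⟩
    have hdiv := div_le_div_of_nonneg_right (hbound L hL) hnn
    simp only [hβ, sub_self, Real.rpow_zero, one_mul] at hdiv
    linarith
end

section
/- Let X be a real random variable that is symmetric (X and −X have the same law) and s²-sub-Gaussian. Let X' be an independent copy of X and let ε be a Rademacher random variable (taking values ±1 with probability 1/2 each) independent of (X, X'). Then ε|X − X'| is 2s²-sub-Gaussian; that is, for all λ ∈ ℝ, E[exp(λ ε |X − X'|)] ≤ exp(λ² s²). In other words, the sub-Gaussian diameter of X is at most √2·s. -/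
open MeasureTheory ProbabilityTheory

/-- A real random variable `X` is `s²`-sub-Gaussian if `E[exp(λX)] ≤ exp(λ²s²/2)` for all `λ`. -/
def IsSubGaussian {Ω : Type*} [MeasureSpace Ω] (s2 : ℝ) (X : Ω → ℝ) : Prop :=
  ∀ l : ℝ, (∫ ω, Real.exp (l * X ω)) ≤ Real.exp (l ^ 2 * s2 / 2)

section Rademacher

variable {Ω : Type*} [MeasurableSpace Ω] {μ : Measure Ω} [IsProbabilityMeasure μ]
  {ε X Y : Ω → ℝ}

lemma ae_eq_one_or_eq_neg_one (hε : Measurable ε)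
    (h₁ : μ {ω | ε ω = 1} = ENNReal.ofReal (1 / 2))
    (h₂ : μ {ω | ε ω = -1} = ENNReal.ofReal (1 / 2)) :
    ∀ᵐ ω ∂μ, ε ω = 1 ∨ ε ω = -1 := by
  have hdisj : Disjoint {ω | ε ω = 1} {ω | ε ω = -1} := by
    rw [Set.disjoint_left]
    intro ω h h'
    norm_num [show ε ω = 1 from h] at h'
  have hm₁ : MeasurableSet {ω | ε ω = 1} := hε (measurableSet_singleton 1)
  have hm₂ : MeasurableSet {ω | ε ω = -1} := hε (measurableSet_singleton (-1))
  have hunion : μ ({ω | ε ω = 1} ∪ {ω | ε ω = -1}) = 1 := by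
    rw [measure_union hdisj hm₂, h₁, h₂, ← ENNReal.ofReal_add (by norm_num) (by norm_num)]
    norm_num
  exact (mem_ae_iff_prob_eq_one (hm₁.union hm₂)).2 hunion

/-- Integrating out an independent Rademacher sign. -/
lemma lintegral_comp_rademacher_mul (hε : Measurable ε) (hY : Measurable Y)
    (h₁ : μ {ω | ε ω = 1} = ENNReal.ofReal (1 / 2))
    (h₂ : μ {ω | ε ω = -1} = ENNReal.ofReal (1 / 2))
    (hind : IndepFun ε Y μ) {g : ℝ → ENNReal} (hg : Measurable g) :
    ∫⁻ ω, g (ε ω * Y ω) ∂μ =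
      ENNReal.ofReal (1 / 2) * ∫⁻ ω, (g (Y ω) + g (-Y ω)) ∂μ := by
  have hI (c : ℝ) : Measurable (({c} : Set ℝ).indicator (1 : ℝ → ENNReal)) :=
    measurable_one.indicator (measurableSet_singleton c)
  have hprod (c : ℝ) (hc : μ {ω | ε ω = c} = ENNReal.ofReal (1 / 2)) {k : ℝ → ENNReal}
      (hk : Measurable k) :
      ∫⁻ ω, ({c} : Set ℝ).indicator 1 (ε ω) * k (Y ω) ∂μ =
        ENNReal.ofReal (1 / 2) * ∫⁻ ω, k (Y ω) ∂μ := by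
    refine (lintegral_mul_eq_lintegral_mul_lintegral_of_indepFun''
      ((hI c).comp hε).aemeasurable (hk.comp hY).aemeasurable (hind.comp (hI c) hk)).trans ?_
    rw [← hc]
    congr 1
    exact lintegral_indicator_one (hε (measurableSet_singleton c))
  have hgn : Measurable fun y => g (-y) := hg.comp measurable_neg
  calc ∫⁻ ω, g (ε ω * Y ω) ∂μ
      = ∫⁻ ω, (({1} : Set ℝ).indicator 1 (ε ω) * g (Y ω) +
          ({-1} : Set ℝ).indicator 1 (ε ω) * g (-Y ω)) ∂μ := by
        refine lintegral_congr_ae ?_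
        filter_upwards [ae_eq_one_or_eq_neg_one hε h₁ h₂] with ω hω
        rcases hω with h | h <;> norm_num [h, Set.indicator]
    _ = _ := by
        rw [lintegral_add_left (((hI 1).fun_comp hε).fun_mul (hg.fun_comp hY)), hprod 1 h₁ hg,
          hprod (-1) h₂ hgn, lintegral_add_left (hg.fun_comp hY), mul_add]

/-- A symmetric random variable has the law of its absolute value times an independent
Rademacher sign. -/
lemma identDistrib_rademacher_mul_abs (hε : Measurable ε) (hY : Measurable Y)
    (h₁ : μ {ω | ε ω = 1} = ENNReal.ofReal (1 / 2))
    (h₂ : μ {ω | ε ω = -1} = ENNReal.ofReal (1 / 2))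
    (hind : IndepFun ε Y μ) (hsymm : IdentDistrib Y (fun ω => -Y ω) μ μ) :
    IdentDistrib (fun ω => ε ω * |Y ω|) Y μ μ := by
  have hεY : Measurable fun ω => ε ω * |Y ω| := hε.mul hY.abs
  refine ⟨hεY.aemeasurable, hY.aemeasurable, Measure.ext_of_lintegral _ fun g hg => ?_⟩
  rw [lintegral_map hg hεY, lintegral_map hg hY,
    lintegral_comp_rademacher_mul hε hY.abs h₁ h₂ (hind.comp measurable_id measurable_abs) hg]
  have habs (y : ℝ) : g |y| + g (-|y|) = g y + g (-y) := by
    rcases abs_choice y with h | h <;> simp [h, add_comm]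
  have hneg : ∫⁻ ω, g (-Y ω) ∂μ = ∫⁻ ω, g (Y ω) ∂μ := (hsymm.comp hg).lintegral_eq.symm
  simp_rw [habs]
  rw [lintegral_add_left (hg.fun_comp hY), hneg, ← two_mul, ← mul_assoc,
    show (2 : ENNReal) = ENNReal.ofReal 2 by simp, ← ENNReal.ofReal_mul (by norm_num)]
  norm_num

/-- The difference of two independent copies of a random variable is symmetric. -/
lemma identDistrib_sub_neg_of_indepFun (hcopy : IdentDistrib X Y μ μ) (hind : IndepFun X Y μ) :
    IdentDistrib (fun ω => X ω - Y ω) (fun ω => -(X ω - Y ω)) μ μ := by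
  have h := (hcopy.prodMk hcopy.symm hind hind.symm).comp (measurable_fst.sub measurable_snd)
  simp only [neg_sub]
  exact h

end Rademacher

/-- if `X` is symmetric and `s²`-sub-Gaussian, `X'` an independent copy of `X`,
and `ε` an independent Rademacher variable, then `ε|X − X'|` is `2s²`-sub-Gaussian, i.e.
`E[exp(λ ε |X − X'|)] ≤ exp(λ² s²)` for all `λ ∈ ℝ`. Hence the sub-Gaussian diameter of `X`
is at most `√2·s`. -/
theorem stmt17 {Ω : Type*} [MeasureSpace Ω] [IsProbabilityMeasure (ℙ : Measure Ω)]
    (s : ℝ) (X X' ε : Ω → ℝ)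
    (hXmeas : Measurable X) (hX'meas : Measurable X') (hεmeas : Measurable ε)
    (hsym : Measure.map X ℙ = Measure.map (fun ω => -X ω) ℙ)
    (hsub : IsSubGaussian (s ^ 2) X)
    (hcopy : IdentDistrib X X' ℙ ℙ)
    (hindepXX' : IndepFun X X' ℙ)
    (hrad1 : ℙ {ω | ε ω = 1} = ENNReal.ofReal (1 / 2))
    (hrad2 : ℙ {ω | ε ω = -1} = ENNReal.ofReal (1 / 2))
    (hindepε : IndepFun ε (fun ω => (X ω, X' ω)) ℙ) :
    ∀ l : ℝ, (∫ ω, Real.exp (l * (ε ω * |X ω - X' ω|))) ≤ Real.exp (l ^ 2 * s ^ 2) := by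
  intro l
  have hdiff : Measurable fun ω => X ω - X' ω := hXmeas.sub hX'meas
  have hdist := identDistrib_rademacher_mul_abs hεmeas hdiff hrad1 hrad2
    (hindepε.comp measurable_id (measurable_fst.sub measurable_snd))
    (identDistrib_sub_neg_of_indepFun hcopy hindepXX')
  have hbound : ∀ t : ℝ, mgf X ℙ t ≤ Real.exp (t ^ 2 * s ^ 2 / 2) := hsub
  calc ∫ ω, Real.exp (l * (ε ω * |X ω - X' ω|))
      = mgf (fun ω => X ω - X' ω) ℙ l := congrFun (mgf_congr_identDistrib hdist) l
    _ = mgf X ℙ l * mgf X ℙ (-l) := by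
        have hind : IndepFun X (-X') ℙ := hindepXX'.comp measurable_id measurable_neg
        have hadd := hind.mgf_add' (t := l) hXmeas.aestronglyMeasurable
          hX'meas.neg.aestronglyMeasurable
        rw [← sub_eq_add_neg, mgf_neg, ← mgf_congr_identDistrib hcopy] at hadd
        exact hadd
    _ ≤ Real.exp (l ^ 2 * s ^ 2 / 2) * Real.exp ((-l) ^ 2 * s ^ 2 / 2) :=
        mul_le_mul (hbound l) (hbound (-l)) mgf_nonneg (Real.exp_pos _).le
    _ = Real.exp (l ^ 2 * s ^ 2) := by
        rw [← Real.exp_add]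
        ring_nf
end
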